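/- Suppose the tail copula R of (X,Y) exists and R(x₀,y₀) > 0 for some x₀,y₀ > 0. Then the tail probability condition P(X ≥ VaR_X(τ), Y ≥ VaR_Y(τ)) > (1−τ)² holds for all τ sufficiently close to 1. Equivalently: if P(X ≥ VaR_X(τ_n), Y ≥ VaR_Y(τ_n)) < (1−τ_n)² along a sequence τ_n → 1 with appropriate normalization, then R(x,y) ≡ 0. -/

import Mathlib

open MeasureTheory Set Filter

noncomputable def distFun {Ω : Type*} [MeasurableSpace Ω] (μ : Measure Ω) (Z : Ω → ℝ) : ℝ → ℝ :=
  fun z => (μ {ω | Z ω ≤ z}).toReal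

noncomputable def VaR {Ω : Type*} [MeasurableSpace Ω] (μ : Measure Ω) (Z : Ω → ℝ) (τ : ℝ) : ℝ :=
  sInf {z : ℝ | τ ≤ distFun μ Z z}

theorem distFun_eq_cdf_aux {Ω : Type*} [MeasurableSpace Ω] (μ : Measure Ω)
    [IsProbabilityMeasure μ] (Z : Ω → ℝ) (hZ : Measurable Z) :
    distFun μ Z = fun z => ProbabilityTheory.cdf (μ.map Z) z := by
  have : IsProbabilityMeasure (μ.map Z) := Measure.isProbabilityMeasure_map hZ.aemeasurable
  funext z
  rw [ProbabilityTheory.cdf_eq_real, measureReal_def, Measure.map_apply hZ measurableSet_Iic]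
  rfl

theorem VaR_mono_aux {Ω : Type*} [MeasurableSpace Ω] (μ : Measure Ω)
    [IsProbabilityMeasure μ] (Z : Ω → ℝ) (hZ : Measurable Z) {p q : ℝ} (hp : 0 < p)
    (hpq : p ≤ q) (hq : q < 1) : VaR μ Z p ≤ VaR μ Z q := by
  unfold VaR
  rw [distFun_eq_cdf_aux μ Z hZ]
  apply csInf_le_csInf
  · obtain ⟨b, hb⟩ := ((ProbabilityTheory.tendsto_cdf_atBot (μ.map Z)).eventually
      (gt_mem_nhds hp)).exists
    refine ⟨b, fun z hz => ?_⟩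
    by_contra! h
    have h1 := ProbabilityTheory.monotone_cdf (μ.map Z) h.le
    have h2 : p ≤ ProbabilityTheory.cdf (μ.map Z) z := hz
    linarith
  · obtain ⟨b, hb⟩ := ((ProbabilityTheory.tendsto_cdf_atTop (μ.map Z)).eventually
      (lt_mem_nhds hq)).exists
    exact ⟨b, hb.le⟩
  · intro z hz
    exact le_trans hpq hz

/-- If the tail copula `R` of `(X,Y)` exists (here written in the equivalent form
`R(x,y) = lim_{t→∞} t·P(X ≥ VaR_X(1−x/t), Y ≥ VaR_Y(1−y/t))`, valid for continuous
margins) and `R(x₀,y₀) > 0` for some `x₀,y₀ > 0`, then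
`P(X ≥ VaR_X(τ), Y ≥ VaR_Y(τ)) > (1−τ)²` for all `τ` sufficiently close to 1. -/
theorem tail_prob_gt_of_tail_copula_pos {Ω : Type*} [MeasurableSpace Ω]
    (μ : Measure Ω) [IsProbabilityMeasure μ]
    (X Y : Ω → ℝ) (hX : Measurable X) (hY : Measurable Y)
    (hFXc : Continuous (distFun μ X)) (hFYc : Continuous (distFun μ Y))
    (R : ℝ → ℝ → ℝ)
    (hR : ∀ x y : ℝ, 0 ≤ x → 0 ≤ y → (x, y) ≠ (0, 0) →
      Tendsto (fun t : ℝ =>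
          t * (μ {ω | VaR μ X (1 - x / t) ≤ X ω ∧ VaR μ Y (1 - y / t) ≤ Y ω}).toReal)
        atTop (nhds (R x y)))
    (x₀ y₀ : ℝ) (hx₀ : 0 < x₀) (hy₀ : 0 < y₀) (hR₀ : 0 < R x₀ y₀) :
    ∃ τ₀ ∈ Set.Ioo (0:ℝ) 1, ∀ τ ∈ Set.Ioo τ₀ 1,
      (1 - τ) ^ 2 < (μ {ω | VaR μ X τ ≤ X ω ∧ VaR μ Y τ ≤ Y ω}).toReal := by
  have hlim := (hR x₀ y₀ hx₀.le hy₀.le (by simp [hx₀.ne'])).eventually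
    (lt_mem_nhds (half_lt_self hR₀))
  obtain ⟨T, hT⟩ := eventually_atTop.1 hlim
  set m := max x₀ y₀ with hm
  have hm0 : 0 < m := lt_max_of_lt_left hx₀
  set r := R x₀ y₀ with hr
  set T' := max T 1 with hT'
  have hT0 : 0 < T' := lt_max_of_lt_right one_pos
  set d := min (1 / 2) (min (m / T') (r / (2 * m))) with hd
  have hd0 : 0 < d := by positivity
  have hd1 : d ≤ 1 / 2 := min_le_left _ _
  have hd2 : d ≤ m / T' := (min_le_right _ _).trans (min_le_left _ _)
  have hd3 : d ≤ r / (2 * m) := (min_le_right _ _).trans (min_le_right _ _)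
  refine ⟨1 - d, ⟨by linarith, by linarith⟩, fun τ hτ => ?_⟩
  obtain ⟨h1, h2⟩ := hτ
  have hs : 0 < 1 - τ := by linarith
  have ht0 : 0 < m / (1 - τ) := div_pos hm0 hs
  have htT : T ≤ m / (1 - τ) := by
    refine (le_max_left T 1).trans ?_
    rw [le_div_iff₀ hs]
    have : (1 - τ) * T' ≤ m := (le_div_iff₀ hT0).1 (by linarith)
    linarith
  have key := hT _ htT
  have aux : ∀ x, 0 < x → x ≤ m → τ ≤ 1 - x / (m / (1 - τ)) ∧ 1 - x / (m / (1 - τ)) < 1 := by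
    intro x hx hxm
    have h3 : 0 < x / (m / (1 - τ)) := div_pos hx ht0
    have h4 : x / (m / (1 - τ)) ≤ 1 - τ := by
      rw [div_le_iff₀ ht0, mul_div_cancel₀ _ hs.ne']
      exact hxm
    constructor <;> linarith
  have hx := aux x₀ hx₀ (le_max_left _ _)
  have hy := aux y₀ hy₀ (le_max_right _ _)
  have hτ0 : 0 < τ := by linarith
  have hVX := VaR_mono_aux μ X hX hτ0 hx.1 hx.2
  have hVY := VaR_mono_aux μ Y hY hτ0 hy.1 hy.2
  have hsub : {ω | VaR μ X (1 - x₀ / (m / (1 - τ))) ≤ X ω ∧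
      VaR μ Y (1 - y₀ / (m / (1 - τ))) ≤ Y ω} ⊆ {ω | VaR μ X τ ≤ X ω ∧ VaR μ Y τ ≤ Y ω} :=
    fun ω hω => ⟨hVX.trans hω.1, hVY.trans hω.2⟩
  refine lt_of_lt_of_le ?_ (ENNReal.toReal_mono (measure_ne_top _ _) (measure_mono hsub))
  generalize (μ {ω | VaR μ X (1 - x₀ / (m / (1 - τ))) ≤ X ω ∧
    VaR μ Y (1 - y₀ / (m / (1 - τ))) ≤ Y ω}).toReal = P at key ⊢
  have h5 : (1 - τ) * (2 * m) < r := (lt_div_iff₀ (by positivity)).1 (by linarith)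
  rw [div_mul_eq_mul_div, lt_div_iff₀ hs] at key
  have h6 : (1 - τ) * ((1 - τ) * (2 * m)) < (1 - τ) * r := mul_lt_mul_of_pos_left h5 hs
  have h7 : m * (1 - τ) ^ 2 < m * P := by nlinarith
  exact lt_of_mul_lt_mul_left h7 hm0.le
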